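/- Suppose I ⊆ K{y_1,…,y_n} is a pure binomial σ-ideal. Then the radical well-mixed closure ⟨I⟩_r is finitely generated as a radical well-mixed σ-ideal, i.e., ⟨I⟩_r = ⟨G⟩_r for some finite set G ⊆ ⟨I⟩_r. -/

import Mathlib

open Polynomial

section SigmaRing

variable {R : Type*} [CommRing R]

/-- A σ-ideal: an ideal closed under the difference operator σ. -/
def IsSigmaIdeal (σ : R →+* R) (I : Ideal R) : Prop := ∀ a ∈ I, σ a ∈ I

/-- A σ-ideal is well-mixed if `a * b ∈ I` implies `a * σ b ∈ I`. -/
def IsWellMixed (σ : R →+* R) (I : Ideal R) : Prop := ∀ a b : R, a * b ∈ I → a * σ b ∈ I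

/-- `[F]`, the smallest σ-ideal containing `F`. -/
def sigmaIdealGen (σ : R →+* R) (F : Set R) : Ideal R :=
  sInf {I : Ideal R | F ⊆ I ∧ IsSigmaIdeal σ I}

/-- `⟨F⟩`, the smallest well-mixed σ-ideal containing `F` (well-mixed closure). -/
def wmClosure (σ : R →+* R) (F : Set R) : Ideal R :=
  sInf {I : Ideal R | F ⊆ I ∧ IsSigmaIdeal σ I ∧ IsWellMixed σ I}

/-- `⟨F⟩_r`, the smallest radical well-mixed σ-ideal containing `F`. -/
def rwmClosure (σ : R →+* R) (F : Set R) : Ideal R :=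
  sInf {I : Ideal R | F ⊆ I ∧ IsSigmaIdeal σ I ∧ IsWellMixed σ I ∧ I.IsRadical}

/-- Symbolic exponent: for `p = Σ c_i x^i ∈ ℕ[x]`, `a^p = Π (σ^i a)^(c_i)`. -/
noncomputable def sexp (σ : R →+* R) (a : R) (p : Polynomial ℕ) : R :=
  ∏ i ∈ Finset.range (p.natDegree + 1), ((⇑σ)^[i] a) ^ (p.coeff i)

/-- `I` is finitely generated as a radical well-mixed σ-ideal. -/
def FinGenAsRWM (σ : R →+* R) (I : Ideal R) : Prop :=
  ∃ G : Set R, G.Finite ∧ G ⊆ (I : Set R) ∧ I = rwmClosure σ G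

/-- σ-prime: a reflexive σ-ideal which is prime. -/
def IsSigmaPrime (σ : R →+* R) (I : Ideal R) : Prop :=
  IsSigmaIdeal σ I ∧ (∀ a : R, σ a ∈ I → a ∈ I) ∧ I.IsPrime

end SigmaRing

/-- The σ-polynomial ring `K{y_1,…,y_n}`: polynomials in variables `y_i^{x^j}`,
indexed by pairs `(i, j) ∈ Fin n × ℕ`. -/
abbrev DPoly (K : Type*) [Field K] (n : ℕ) := MvPolynomial (Fin n × ℕ) K

section DPoly

variable {K : Type*} [Field K] {n : ℕ} (σK : K →+* K)

/-- The difference operator on `K{y_1,…,y_n}` extending `σK`, with `σ(y_i^{x^j}) = y_i^{x^{j+1}}`. -/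
noncomputable def shift : DPoly K n →+* DPoly K n :=
  MvPolynomial.eval₂Hom ((MvPolynomial.C : K →+* DPoly K n).comp σK)
    (fun v => MvPolynomial.X (v.1, v.2 + 1))

/-- `y_i^p` for `p ∈ ℕ[x]`. -/
noncomputable def ypow (i : Fin n) (p : Polynomial ℕ) : DPoly K n :=
  sexp (shift σK) (MvPolynomial.X (i, 0)) p

/-- `y_i^{x^a}`. -/
noncomputable def varPow (i : Fin n) (a : ℕ) : DPoly K n :=
  ypow σK i (Polynomial.X ^ a)

/-- The monomial `Y^f = Π y_i^{f_i}` for `f ∈ ℕ[x]^n`. -/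
noncomputable def monom (f : Fin n → Polynomial ℕ) : DPoly K n :=
  ∏ i, ypow σK i (f i)

/-- A pure binomial `Y^f − Y^g`. -/
def IsPureBinomial (p : DPoly K n) : Prop :=
  ∃ f g : Fin n → Polynomial ℕ, p = monom σK f - monom σK g

/-- A binomial `a·Y^f + b·Y^g` with `a, b ∈ K^×`. -/
def IsBinomial (p : DPoly K n) : Prop :=
  ∃ (a b : K) (f g : Fin n → Polynomial ℕ), a ≠ 0 ∧ b ≠ 0 ∧
    p = MvPolynomial.C a * monom σK f + MvPolynomial.C b * monom σK g

/-- A pure binomial σ-ideal: a σ-ideal generated by pure binomials. -/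
def IsPureBinomialSigmaIdeal (I : Ideal (DPoly K n)) : Prop :=
  ∃ S : Set (DPoly K n), (∀ p ∈ S, IsPureBinomial σK p) ∧ I = sigmaIdealGen (shift σK) S

/-- Positive part of `f ∈ ℤ[x]`. -/
noncomputable def posPart (f : Polynomial ℤ) : Polynomial ℕ :=
  f.sum fun i c => Polynomial.monomial i c.toNat

/-- Negative part of `f ∈ ℤ[x]`. -/
noncomputable def negPart (f : Polynomial ℤ) : Polynomial ℕ :=
  f.sum fun i c => Polynomial.monomial i (-c).toNat

/-- The lattice σ-ideal `I_L = [Y^{f_+} − Y^{f_−} : f ∈ L]` of a ℤ[x]-lattice `L ⊆ ℤ[x]^n`. -/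
noncomputable def latticeIdeal (L : Submodule (Polynomial ℤ) (Fin n → Polynomial ℤ)) :
    Ideal (DPoly K n) :=
  sigmaIdealGen (shift σK)
    {p | ∃ f ∈ L, p = monom σK (fun i => posPart (f i)) - monom σK (fun i => negPart (f i))}

end DPoly

/-- `𝔪`: the multiplicatively closed set generated by the variables `y_i^{x^j}`. -/
def mSet (K : Type*) [Field K] (n : ℕ) : Set (DPoly K n) :=
  (Submonoid.closure (Set.range fun v : Fin n × ℕ => (MvPolynomial.X v : DPoly K n)) : Set _)

/-- `I : 𝔪 = {p : M p ∈ I for some M ∈ 𝔪}`. -/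
def colonM {K : Type*} [Field K] {n : ℕ} (I : Ideal (DPoly K n)) : Set (DPoly K n) :=
  {p | ∃ M ∈ mSet K n, M * p ∈ I}

section Tsec

variable {K : Type*} [Field K] {n t : ℕ} (σK : K →+* K)

/-- The set `T^{a_1…a_t}_{j_1…j_t}` of monomials `Y^f` with `deg f_{j_i} < a_i`. -/
def Tset (j : Fin t → Fin n) (a : Fin t → ℕ) : Set (DPoly K n) :=
  {p | ∃ f : Fin n → Polynomial ℕ,
    (∀ i : Fin t, (f (j i)).degree < (a i : WithBot ℕ)) ∧ p = monom σK f}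

/-- `I` is saturated with respect to `{y_{j_1}^{x^{a_1}},…,y_{j_t}^{x^{a_t}}}`. -/
def SaturatedWrt (j : Fin t → Fin n) (a : Fin t → ℕ) (I : Ideal (DPoly K n)) : Prop :=
  ∀ g M : DPoly K n, M ∈ Tset σK j a → M * g ∈ I → g ∈ I

/-- `J : T = {g : M g ∈ J for some M ∈ T}`. -/
def colonT (j : Fin t → Fin n) (a : Fin t → ℕ) (J : Ideal (DPoly K n)) : Set (DPoly K n) :=
  {g | ∃ M ∈ Tset σK j a, M * g ∈ J}

/-- The `T`-saturated closure `N^{a_1…a_t}_{j_1…j_t}(I)`: the smallest saturated σ-ideal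
containing `I`. -/
noncomputable def Nclosure (j : Fin t → Fin n) (a : Fin t → ℕ) (I : Ideal (DPoly K n)) :
    Ideal (DPoly K n) :=
  sInf {J : Ideal (DPoly K n) | I ≤ J ∧ IsSigmaIdeal (shift σK) J ∧ SaturatedWrt σK j a J}

/-- The set of variables `{y_{j_1}^{x^{a_1}},…,y_{j_t}^{x^{a_t}}}`. -/
noncomputable def varSet (j : Fin t → Fin n) (a : Fin t → ℕ) : Set (DPoly K n) :=
  Set.range fun i => varPow σK (j i) (a i)

/-- `⟨I₀ ∪ {y_{j_1}^{x^{a_1}},…,y_{j_t}^{x^{a_t}}}⟩_r` is quasi-normal. -/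
def QuasiNormal (j : Fin t → Fin n) (a : Fin t → ℕ) (I0 : Ideal (DPoly K n)) : Prop :=
  SaturatedWrt σK j a I0 ∧
  ∀ f g : Fin n → Polynomial ℕ, monom σK f - monom σK g ∈ I0 →
    monom σK f ∈ sigmaIdealGen (shift σK) (varSet σK j a) →
    monom σK g ∈ sigmaIdealGen (shift σK) (varSet σK j a)

end Tsec

section BinomialState

open Filter

/-- Translation by `s` of the second coordinate: the action of `σ^s` on the variables `y_i^{x^j}`. -/
def shiftVar {n : ℕ} (s : ℕ) (v : Fin n × ℕ) : Fin n × ℕ := (v.1, v.2 + s)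

lemma shiftVar_injective {n : ℕ} (s : ℕ) :
    Function.Injective (shiftVar s : Fin n × ℕ → Fin n × ℕ) := by
  rintro ⟨i, j⟩ ⟨i', j'⟩ h
  simpa [shiftVar] using h

/-- The combinatorial shadow of a prime σ-ideal: the variables it contains, and the lattice of
exponent differences of the pure binomials it contains whose monomials it does not contain. -/
structure BinomialState (n : ℕ) where
  /-- The variables which vanish. -/
  dead : Set (Fin n × ℕ)
  /-- The differences of exponents of pure binomials with nonvanishing monomials. -/
  lat : AddSubgroup (Fin n × ℕ →₀ ℤ)
  shift_dead : ∀ v ∈ dead, ∀ s, shiftVar s v ∈ dead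
  alive : ∀ h ∈ lat, ∀ v ∈ h.support, v ∉ dead
  shift_lat : ∀ h ∈ lat, ∀ s, (∀ v ∈ h.support, shiftVar s v ∉ dead) →
    h.mapDomain (shiftVar s) ∈ lat
  balanced : ∀ h ∈ lat, ∀ s, ∀ v, 0 < h v → shiftVar s v ∈ dead →
    ∃ w, h w < 0 ∧ shiftVar s w ∈ dead

namespace BinomialState

variable {n : ℕ}

/-- The monomial with exponent `u` vanishes. -/
def Vanishes (S : BinomialState n) (u : Fin n × ℕ →₀ ℕ) : Prop := ∃ v ∈ u.support, v ∈ S.dead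

/-- The integer exponent of a quotient of two monomials. -/
noncomputable def diff (u v : Fin n × ℕ →₀ ℕ) : Fin n × ℕ →₀ ℤ :=
  u.mapRange Nat.cast Nat.cast_zero - v.mapRange Nat.cast Nat.cast_zero

@[simp] lemma diff_apply (u v : Fin n × ℕ →₀ ℕ) (w : Fin n × ℕ) :
    diff u v w = (u w : ℤ) - v w := by
  simp [diff]

/-- The pure binomial with exponents `u` and `v` vanishes. -/
def Holds (S : BinomialState n) (u v : Fin n × ℕ →₀ ℕ) : Prop :=
  (S.Vanishes u ∧ S.Vanishes v) ∨ (¬ S.Vanishes u ∧ ¬ S.Vanishes v ∧ diff u v ∈ S.lat)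

/-- Some variable of index `i` vanishes. -/
def Mortal (S : BinomialState n) (i : Fin n) : Prop := ∃ j, (i, j) ∈ S.dead

/-- The least order at which the variable of index `i` vanishes (zero if there is none). -/
noncomputable def death (S : BinomialState n) (i : Fin n) : ℕ := sInf {j | (i, j) ∈ S.dead}

lemma mem_dead_iff (S : BinomialState n) (v : Fin n × ℕ) :
    v ∈ S.dead ↔ S.Mortal v.1 ∧ S.death v.1 ≤ v.2 := by
  obtain ⟨i, j⟩ := v
  refine ⟨fun h => ⟨⟨j, h⟩, Nat.sInf_le h⟩, fun ⟨h, hj⟩ => ?_⟩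
  have := S.shift_dead _ (Nat.sInf_mem (s := {j | (i, j) ∈ S.dead}) h) (j - S.death i)
  rwa [shiftVar, ← death, Nat.add_sub_cancel' hj] at this

open Classical in
/-- The key by which variables are compared: those vanishing earlier are larger. -/
noncomputable def key (S : BinomialState n) (v : Fin n × ℕ) : ℕ ×ₗ (ℤ ×ₗ Fin n) :=
  toLex (if S.Mortal v.1 then 1 else 0, toLex ((v.2 : ℤ) - S.death v.1, v.1))

lemma key_shiftVar_le (S : BinomialState n) {v w : Fin n × ℕ} (s : ℕ) (h : S.key v ≤ S.key w) :
    S.key (shiftVar s v) ≤ S.key (shiftVar s w) := by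
  simp only [key, shiftVar, Prod.Lex.toLex_le_toLex] at h ⊢
  grind

lemma key_lt_of_lt (S : BinomialState n) (i : Fin n) {j k : ℕ} (h : j < k) :
    S.key (i, j) < S.key (i, k) := by
  simp [key, Prod.Lex.toLex_lt_toLex, h]

lemma key_injective (S : BinomialState n) : Function.Injective S.key := by
  rintro ⟨i, j⟩ ⟨i', j'⟩ h
  simp only [key, EmbeddingLike.apply_eq_iff_eq, Prod.mk.injEq] at h
  obtain ⟨-, h, rfl⟩ := h
  simpa using h

lemma dead_of_key_le (S : BinomialState n) {v w : Fin n × ℕ} (h : S.key v ≤ S.key w)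
    (hv : v ∈ S.dead) : w ∈ S.dead := by
  rw [mem_dead_iff] at hv ⊢
  simp only [key, Prod.Lex.toLex_le_toLex, hv.1] at h
  grind

lemma shift_mem_lat (S : BinomialState n) {h : Fin n × ℕ →₀ ℤ} (hh : h ∈ S.lat) {v : Fin n × ℕ}
    (hv : ∀ w ∈ h.support, S.key w ≤ S.key v) {s : ℕ} (hs : shiftVar s v ∉ S.dead) :
    h.mapDomain (shiftVar s) ∈ S.lat :=
  S.shift_lat h hh s fun w hw hd => hs (S.dead_of_key_le (S.key_shiftVar_le s (hv w hw)) hd)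

/-- If the largest variable `v` of a lattice element is mortal, then a variable of opposite sign
vanishes after exactly as many shifts as `v`. -/
lemma exists_opposite (S : BinomialState n) {h : Fin n × ℕ →₀ ℤ} (hh : h ∈ S.lat)
    {v : Fin n × ℕ} (hv : ∀ w ∈ h.support, S.key w ≤ S.key v) (hm : S.Mortal v.1)
    (hv0 : h v ≠ 0) :
    ∃ w ∈ h.support, h w * h v < 0 ∧ S.Mortal w.1 ∧
      (S.death w.1 : ℤ) - S.death v.1 = w.2 - v.2 := by
  have hlt : v.2 < S.death v.1 := by
    have := S.alive h hh v (by simpa using hv0)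
    rw [mem_dead_iff] at this
    grind
  have hd : shiftVar (S.death v.1 - v.2) v ∈ S.dead := by
    rw [mem_dead_iff]
    exact ⟨hm, by simp only [shiftVar]; omega⟩
  obtain ⟨w, hw, hwd⟩ : ∃ w, h w * h v < 0 ∧ shiftVar (S.death v.1 - v.2) w ∈ S.dead := by
    rcases hv0.lt_or_gt with h0 | h0
    · obtain ⟨w, hw, hwd⟩ := S.balanced (-h) (neg_mem hh) _ v (by simpa using h0) hd
      exact ⟨w, mul_neg_of_pos_of_neg (by simpa using hw) h0, hwd⟩
    · obtain ⟨w, hw, hwd⟩ := S.balanced h hh _ v h0 hd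
      exact ⟨w, mul_neg_of_neg_of_pos hw h0, hwd⟩
  have hws : w ∈ h.support := by
    rw [Finsupp.mem_support_iff]
    rintro h0
    simp [h0] at hw
  rw [mem_dead_iff] at hwd
  simp only [shiftVar] at hwd
  refine ⟨w, hws, hw, hwd.1, ?_⟩
  have := hv w hws
  simp only [key, Prod.Lex.toLex_le_toLex, hwd.1, hm] at this
  grind

section Limit

variable {ι : Type*} (U : Ultrafilter ι) (st : ι → BinomialState n)

/-- The limit of the keys of a family of states along an ultrafilter. -/
noncomputable def limKey (v : Fin n × ℕ) : Germ (U : Filter ι) (ℕ ×ₗ (ℤ ×ₗ Fin n)) :=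
  ((fun t => (st t).key v : ι → ℕ ×ₗ (ℤ ×ₗ Fin n)) : Germ (U : Filter ι) _)

lemma limKey_le_iff {v w : Fin n × ℕ} :
    limKey U st v ≤ limKey U st w ↔ ∀ᶠ t in U, (st t).key v ≤ (st t).key w := Germ.coe_le

lemma limKey_lt_iff {v w : Fin n × ℕ} :
    limKey U st v < limKey U st w ↔ ∀ᶠ t in U, (st t).key v < (st t).key w := Germ.coe_lt

lemma limKey_injective : Function.Injective (limKey U st) := fun v w h => by
  obtain ⟨t, ht⟩ := (Germ.coe_eq.1 h : ∀ᶠ t in U, (st t).key v = (st t).key w).exists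
  exact (st t).key_injective ht

lemma limKey_lt_of_lt (i : Fin n) {j k : ℕ} (h : j < k) :
    limKey U st (i, j) < limKey U st (i, k) :=
  (limKey_lt_iff U st).2 (Eventually.of_forall fun t => (st t).key_lt_of_lt i h)

lemma limKey_wellFounded : WellFounded (InvImage (· < ·) (limKey U st)) := by
  rw [WellFounded.wellFounded_iff_has_min]
  rintro s ⟨⟨i₀, j₀⟩, h₀⟩
  classical
  let m : Fin n → ℕ := fun i => sInf {j | (i, j) ∈ s}
  have hm : ∀ i j, (i, j) ∈ s → (i, m i) ∈ s ∧ m i ≤ j := fun i j h =>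
    ⟨Nat.sInf_mem (s := {j | (i, j) ∈ s}) ⟨j, h⟩, Nat.sInf_le h⟩
  obtain ⟨i, hi, hmin⟩ := Finset.exists_min_image
    (Finset.univ.filter fun i => (i, m i) ∈ s) (fun i => limKey U st (i, m i))
    ⟨i₀, by simpa using (hm i₀ j₀ h₀).1⟩
  refine ⟨(i, m i), by simpa using hi, ?_⟩
  rintro ⟨k, l⟩ hkl hlt
  obtain ⟨h1, h2⟩ := hm k l hkl
  have h3 := hmin k (by simpa using h1)
  have h4 : limKey U st (k, m k) ≤ limKey U st (k, l) := by
    rcases h2.eq_or_lt with h | h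
    · rw [h]
    · exact (limKey_lt_of_lt U st k h).le
  exact absurd (hlt : limKey U st (k, l) < limKey U st (i, m i)) (h3.trans h4).not_gt

/-- The limit lattice of a family of states along an ultrafilter. -/
def limLat : AddSubgroup (Fin n × ℕ →₀ ℤ) where
  carrier := {h | ∀ᶠ t in U, h ∈ (st t).lat}
  zero_mem' := Eventually.of_forall fun t => zero_mem _
  add_mem' := fun ha hb => by
    filter_upwards [ha, hb] with t h1 h2 using add_mem h1 h2
  neg_mem' := fun ha => by
    filter_upwards [ha] with t h1 using neg_mem h1

lemma mem_limLat {h : Fin n × ℕ →₀ ℤ} : h ∈ limLat U st ↔ ∀ᶠ t in U, h ∈ (st t).lat := Iff.rfl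

/-- All variables occurring in `h` are at most `v` in the limit order. -/
def Below (v : Fin n × ℕ) (h : Fin n × ℕ →₀ ℤ) : Prop :=
  ∀ w ∈ h.support, limKey U st w ≤ limKey U st v

variable {U st}

lemma Below.eventually {v : Fin n × ℕ} {h : Fin n × ℕ →₀ ℤ} (hb : Below U st v h) :
    ∀ᶠ t in U, ∀ w ∈ h.support, (st t).key w ≤ (st t).key v :=
  (Filter.eventually_all_finset _).2 fun w hw => (limKey_le_iff U st).1 (hb w hw)

lemma Below.add {v : Fin n × ℕ} {h k : Fin n × ℕ →₀ ℤ} (hh : Below U st v h)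
    (hk : Below U st v k) : Below U st v (h + k) := fun w hw => by
  classical
  rcases Finset.mem_union.1 (Finsupp.support_add hw) with h1 | h1
  exacts [hh w h1, hk w h1]

lemma Below.smul {v : Fin n × ℕ} {h : Fin n × ℕ →₀ ℤ} (hh : Below U st v h) (m : ℤ) :
    Below U st v (m • h) := fun w hw => hh w (Finsupp.support_smul hw)

lemma Below.shift {v : Fin n × ℕ} {h : Fin n × ℕ →₀ ℤ} (hh : Below U st v h) (s : ℕ) :
    Below U st (shiftVar s v) (h.mapDomain (shiftVar s)) := fun w hw => by
  classical
  obtain ⟨w, hw', rfl⟩ := Finset.mem_image.1 (Finsupp.mapDomain_support hw)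
  exact (limKey_le_iff U st).2 (((limKey_le_iff U st).1 (hh w hw')).mono
    fun t ht => (st t).key_shiftVar_le s ht)

lemma shift_mem_limLat {v : Fin n × ℕ} {h : Fin n × ℕ →₀ ℤ} (hh : h ∈ limLat U st)
    (hb : Below U st v h) {s : ℕ} (hs : ∀ᶠ t in U, shiftVar s v ∉ (st t).dead) :
    h.mapDomain (shiftVar s) ∈ limLat U st := by
  filter_upwards [hh, hb.eventually, hs] with t h1 h2 h3 using (st t).shift_mem_lat h1 h2 h3

variable (U st) in
/-- The leading coefficients at `v` of elements of the limit lattice (everything if `v` vanishes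
in the limit). -/
def leadIdeal (v : Fin n × ℕ) : Ideal ℤ where
  carrier := {c | (∀ᶠ t in U, v ∉ (st t).dead) → ∃ h ∈ limLat U st, Below U st v h ∧ h v = c}
  zero_mem' := fun _ => ⟨0, zero_mem _, fun w hw => by simp at hw, rfl⟩
  add_mem' := fun ha hb hv => by
    obtain ⟨h, hh, hhb, rfl⟩ := ha hv
    obtain ⟨k, hk, hkb, rfl⟩ := hb hv
    exact ⟨h + k, add_mem hh hk, hhb.add hkb, rfl⟩
  smul_mem' := fun m c hc hv => by
    obtain ⟨h, hh, hhb, rfl⟩ := hc hv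
    exact ⟨m • h, zsmul_mem hh m, hhb.smul m, rfl⟩

lemma leadIdeal_mono (i : Fin n) : Monotone fun j => leadIdeal U st (i, j) := by
  refine monotone_nat_of_le_succ fun j c hc hv => ?_
  have hs : shiftVar 1 (i, j) = (i, j + 1) := rfl
  obtain ⟨h, hh, hb, rfl⟩ := hc (hv.mono fun t ht hd => ht ((st t).shift_dead _ hd 1))
  refine ⟨_, shift_mem_limLat hh hb hv, hb.shift 1, ?_⟩
  rw [← hs, Finsupp.mapDomain_apply (shiftVar_injective 1)]

variable (U st) in
/-- A finite Gröbner basis of the limit lattice, up to shifts. -/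
lemma exists_basis : ∃ (B : Finset (Fin n × ℕ)) (g : Fin n × ℕ → Fin n × ℕ →₀ ℤ),
    (∀ v, g v ∈ limLat U st ∧ Below U st v (g v)) ∧
    ∀ v, (∀ᶠ t in U, v ∉ (st t).dead) → ∃ w ∈ B, ∃ s, shiftVar s w = v ∧
      ∀ h ∈ limLat U st, Below U st v h → g w w ∣ h v := by
  have hg : ∀ v, ∃ g ∈ limLat U st, Below U st v g ∧ ((∀ᶠ t in U, v ∉ (st t).dead) →
      ∀ c ∈ leadIdeal U st v, g v ∣ c) := fun v => by
    by_cases hv : ∀ᶠ t in U, v ∉ (st t).dead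
    · obtain ⟨g, hg, hb, he⟩ :=
        Submodule.IsPrincipal.generator_mem (leadIdeal U st v) hv
      refine ⟨g, hg, hb, fun _ c hc => ?_⟩
      rw [he]
      exact (Submodule.IsPrincipal.mem_iff_generator_dvd _).1 hc
    · exact ⟨0, zero_mem _, fun w hw => by simp at hw, fun h => absurd h hv⟩
  choose g hg hb hd using hg
  have hJ : ∀ i : Fin n, ∃ J, ∀ j, J ≤ j → leadIdeal U st (i, J) = leadIdeal U st (i, j) :=
    fun i => monotone_stabilizes_iff_noetherian.2 inferInstance ⟨_, leadIdeal_mono i⟩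
  choose J hJ using hJ
  refine ⟨Finset.univ.sigma (fun i => Finset.range (J i + 1)) |>.map
    (Equiv.sigmaEquivProd _ _).toEmbedding, g, fun v => ⟨hg v, hb v⟩, ?_⟩
  rintro ⟨i, j⟩ hv
  have hmin : shiftVar (j - min j (J i)) (i, min j (J i)) = (i, j) := by
    simp only [shiftVar, Prod.mk.injEq, true_and]
    omega
  have halive : ∀ᶠ t in U, (i, min j (J i)) ∉ (st t).dead :=
    hv.mono fun t ht hd' => ht (hmin ▸ (st t).shift_dead _ hd' _)
  refine ⟨(i, min j (J i)), ?_, _, hmin, fun h hh hhb => hd _ halive _ ?_⟩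
  · simp
  · have : leadIdeal U st (i, min j (J i)) = leadIdeal U st (i, j) := by
      rcases le_total j (J i) with h | h
      · rw [min_eq_left h]
      · rw [min_eq_right h, hJ i j h]
    rw [this]
    exact fun _ => ⟨h, hh, hhb, rfl⟩

variable (U st) in
lemma eventually_mortal_iff :
    ∀ᶠ t in U, ∀ i, (st t).Mortal i ↔ ∀ᶠ t' in U, (st t').Mortal i := by
  refine Filter.eventually_all.2 fun i => ?_
  by_cases h : ∀ᶠ t' in U, (st t').Mortal i
  · exact h.mono fun t ht => iff_of_true ht h
  · exact (Ultrafilter.eventually_not.2 h).mono fun t ht => iff_of_false ht h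

variable (U st) in
lemma eventually_death_sub : ∀ᶠ t in U, ∀ i k, ∀ d : ℤ,
    (∀ᶠ t' in U, ((st t').death i : ℤ) - (st t').death k = d) →
    ((st t).death i : ℤ) - (st t).death k = d := by
  refine Filter.eventually_all.2 fun i => Filter.eventually_all.2 fun k => ?_
  by_cases h : ∃ d : ℤ, ∀ᶠ t' in U, ((st t').death i : ℤ) - (st t').death k = d
  · obtain ⟨d, hd⟩ := h
    filter_upwards [hd] with t ht e he
    obtain ⟨t', h1, h2⟩ := (hd.and he).exists
    omega
  · exact Eventually.of_forall fun t d hd => absurd ⟨d, hd⟩ h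

variable (U st) in
lemma eventually_dead : ∀ᶠ t in U, ∀ v, (∀ᶠ t' in U, v ∈ (st t').dead) → v ∈ (st t).dead := by
  have : ∀ i : Fin n, ∀ᶠ t in U, ∀ j, (∀ᶠ t' in U, (i, j) ∈ (st t').dead) →
      (i, j) ∈ (st t).dead := fun i => by
    by_cases h : ∃ j, ∀ᶠ t' in U, (i, j) ∈ (st t').dead
    · have hmin := Nat.sInf_mem (s := {j | ∀ᶠ t' in U, (i, j) ∈ (st t').dead}) h
      filter_upwards [hmin] with t ht j hj
      have hle : sInf {j | ∀ᶠ t' in U, (i, j) ∈ (st t').dead} ≤ j := Nat.sInf_le hj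
      have := (st t).shift_dead _ ht (j - sInf {j | ∀ᶠ t' in U, (i, j) ∈ (st t').dead})
      rwa [shiftVar, Nat.add_sub_cancel' hle] at this
    · exact Eventually.of_forall fun t j hj => absurd ⟨j, hj⟩ h
  filter_upwards [Filter.eventually_all.2 this] with t ht v hv using ht v.1 v.2 hv

variable (U st) in
/-- Almost every state contains each element of the limit lattice, unless it kills variables of
both signs in it. -/
lemma eventually_limLat : ∀ᶠ t in U, ∀ h ∈ limLat U st, h ∈ (st t).lat ∨
    ((∃ v ∈ (st t).dead, 0 < h v) ∧ ∃ v ∈ (st t).dead, h v < 0) := by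
  obtain ⟨B, g, hg, hB⟩ := exists_basis U st
  have hgB : ∀ᶠ t in U, ∀ w ∈ B, g w ∈ (st t).lat ∧
      ∀ w' ∈ (g w).support, (st t).key w' ≤ (st t).key w :=
    (Filter.eventually_all_finset _).2 fun w _ =>
      ((mem_limLat U st).1 (hg w).1).and (hg w).2.eventually
  filter_upwards [hgB, eventually_mortal_iff U st, eventually_death_sub U st] with t htB htm htd
  suffices H : ∀ v, ∀ h ∈ limLat U st, Below U st v h → h v ≠ 0 → h ∈ (st t).lat ∨
      ((∃ v ∈ (st t).dead, 0 < h v) ∧ ∃ v ∈ (st t).dead, h v < 0) by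
    intro h hh
    rcases eq_or_ne h 0 with rfl | h0
    · exact Or.inl (zero_mem _)
    obtain ⟨v, hv, hmax⟩ := Finset.exists_max_image h.support (limKey U st)
      (Finsupp.support_nonempty_iff.2 h0)
    exact H v h hh hmax (Finsupp.mem_support_iff.1 hv)
  intro v
  induction v using (limKey_wellFounded U st).induction with
  | _ v ih =>
  intro h hh hb hv0
  by_cases hvd : v ∈ (st t).dead
  · right
    rw [mem_dead_iff] at hvd
    have hop : ∀ᶠ t' in U, ∃ w ∈ h.support, h w * h v < 0 ∧ (st t').Mortal w.1 ∧
        ((st t').death w.1 : ℤ) - (st t').death v.1 = w.2 - v.2 := by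
      filter_upwards [hh, hb.eventually, (htm v.1).1 hvd.1] with t' h1 h2 h3
      exact (st t').exists_opposite h1 h2 h3 hv0
    obtain ⟨w, hw, hw'⟩ :=
      (Ultrafilter.eventually_exists_mem_iff h.support.finite_toSet).1 hop
    have hsign : h w * h v < 0 := hw'.exists.choose_spec.1
    have hwd : w ∈ (st t).dead := by
      rw [mem_dead_iff]
      refine ⟨(htm w.1).2 (hw'.mono fun _ h => h.2.1), ?_⟩
      have := htd w.1 v.1 _ (hw'.mono fun _ h => h.2.2)
      omega
    rw [← mem_dead_iff] at hvd
    rcases mul_neg_iff.1 hsign with ⟨h1, h2⟩ | ⟨h1, h2⟩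
    · exact ⟨⟨w, hwd, h1⟩, v, hvd, h2⟩
    · exact ⟨⟨v, hvd, h2⟩, w, hwd, h1⟩
  · have hval : ∀ᶠ t' in U, v ∉ (st t').dead :=
      ((mem_limLat U st).1 hh).mono fun t' ht' => (st t').alive h ht' v (by simpa using hv0)
    obtain ⟨w, hw, s, rfl, hdvd⟩ := hB v hval
    obtain ⟨m, hm⟩ := hdvd h hh hb
    set k := (g w).mapDomain (shiftVar s) with hk
    have hkL : k ∈ limLat U st := shift_mem_limLat (hg w).1 (hg w).2 hval
    have hkt : k ∈ (st t).lat := (st t).shift_mem_lat (htB w hw).1 (htB w hw).2 hvd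
    have hkb : Below U st (shiftVar s w) k := (hg w).2.shift s
    have hkv : k (shiftVar s w) = g w w := Finsupp.mapDomain_apply (shiftVar_injective s) _ _
    have hrec : h + (-m) • k ∈ (st t).lat ∨ ((∃ v ∈ (st t).dead, 0 < (h + (-m) • k) v) ∧
        ∃ v ∈ (st t).dead, (h + (-m) • k) v < 0) := by
      rcases eq_or_ne (h + (-m) • k) 0 with h0 | h0
      · exact Or.inl (h0 ▸ zero_mem _)
      obtain ⟨v', hv', hmax⟩ := Finset.exists_max_image _ (limKey U st)
        (Finsupp.support_nonempty_iff.2 h0)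
      refine ih v' (lt_of_le_of_ne ((hb.add (hkb.smul (-m))) v' hv') fun he => ?_) _
        (add_mem hh (zsmul_mem hkL _)) hmax (Finsupp.mem_support_iff.1 hv')
      rw [limKey_injective U st he, Finsupp.mem_support_iff] at hv'
      exact hv' (by simp [hkv, hm, mul_comm])
    have heq : ∀ v ∈ (st t).dead, (h + (-m) • k) v = h v := fun v hv => by
      have : k v = 0 := by
        by_contra h0
        exact (st t).alive k hkt v (by simpa using h0) hv
      simp [this]
    rcases hrec with h1 | ⟨⟨a, ha, ha'⟩, b, hb, hb'⟩
    · left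
      have := add_mem h1 (zsmul_mem hkt m)
      rwa [neg_smul, neg_add_cancel_right] at this
    · exact Or.inr ⟨⟨a, ha, heq a ha ▸ ha'⟩, b, hb, heq b hb ▸ hb'⟩

variable (U st) in
/-- Almost every state satisfies all the pure binomial equations which hold in the limit. -/
theorem eventually_holds : ∀ᶠ t in U, ∀ u v : Fin n × ℕ →₀ ℕ,
    (∀ᶠ t' in U, (st t').Holds u v) → (st t).Holds u v := by
  filter_upwards [eventually_limLat U st, eventually_dead U st] with t htL htd u v huv
  have hvan : ∀ u, (∀ᶠ t' in U, (st t').Vanishes u) → (st t).Vanishes u := fun u hu => by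
    obtain ⟨w, hw, h⟩ := (Ultrafilter.eventually_exists_mem_iff u.support.finite_toSet).1 hu
    exact ⟨w, hw, htd w h⟩
  rcases Ultrafilter.eventually_or.1 huv with h | h
  · exact Or.inl ⟨hvan u (h.mono fun _ h => h.1), hvan v (h.mono fun _ h => h.2)⟩
  · rcases htL (diff u v) (h.mono fun _ h => h.2.2) with hL | ⟨⟨a, ha, ha'⟩, b, hb, hb'⟩
    · have key : ∀ w ∈ (st t).dead, u w = v w := fun w hw => by
        by_contra hne
        refine (st t).alive _ hL w ?_ hw
        simp only [Finsupp.mem_support_iff, diff_apply]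
        omega
      by_cases hu : (st t).Vanishes u
      · obtain ⟨w, hw, hwd⟩ := hu
        refine Or.inl ⟨⟨w, hw, hwd⟩, w, ?_, hwd⟩
        rwa [Finsupp.mem_support_iff, ← key w hwd, ← Finsupp.mem_support_iff]
      · refine Or.inr ⟨hu, ?_, hL⟩
        rintro ⟨w, hw, hwd⟩
        refine hu ⟨w, ?_, hwd⟩
        rwa [Finsupp.mem_support_iff, key w hwd, ← Finsupp.mem_support_iff]
    · rw [diff_apply] at ha' hb'
      exact Or.inl ⟨⟨a, by rw [Finsupp.mem_support_iff]; omega, ha⟩,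
        b, by rw [Finsupp.mem_support_iff]; omega, hb⟩

end Limit

end BinomialState

end BinomialState

section RadicalWellMixed

variable {R : Type*} [CommRing R] (σ : R →+* R)

lemma subset_rwmClosure (F : Set R) : F ⊆ rwmClosure σ F := fun a ha => by
  simp only [rwmClosure, SetLike.mem_coe, Submodule.mem_sInf]
  exact fun I hI => hI.1 ha

variable {σ}

lemma rwmClosure_le {F : Set R} {J : Ideal R} (hF : F ⊆ J) (hσ : IsSigmaIdeal σ J)
    (hw : IsWellMixed σ J) (hr : J.IsRadical) : rwmClosure σ F ≤ J :=
  sInf_le ⟨hF, hσ, hw, hr⟩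

variable (σ)

lemma isSigmaIdeal_rwmClosure (F : Set R) : IsSigmaIdeal σ (rwmClosure σ F) := fun a ha => by
  simp only [rwmClosure, Submodule.mem_sInf] at ha ⊢
  exact fun I hI => hI.2.1 a (ha I hI)

lemma isWellMixed_rwmClosure (F : Set R) : IsWellMixed σ (rwmClosure σ F) := fun a b hab => by
  simp only [rwmClosure, Submodule.mem_sInf] at hab ⊢
  exact fun I hI => hI.2.2.1 a b (hab I hI)

lemma isRadical_rwmClosure (F : Set R) : (rwmClosure σ F).IsRadical := fun a ⟨m, hm⟩ => by
  simp only [rwmClosure, Submodule.mem_sInf] at hm ⊢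
  exact fun I hI => hI.2.2.2 ⟨m, hm I hI⟩

variable {σ}

/-- A radical well-mixed σ-ideal is an intersection of prime σ-ideals. -/
lemma exists_prime_sigmaIdeal {J : Ideal R} (hσ : IsSigmaIdeal σ J) (hw : IsWellMixed σ J)
    (hr : J.IsRadical) {a : R} (ha : a ∉ J) :
    ∃ P : Ideal R, P.IsPrime ∧ IsSigmaIdeal σ P ∧ J ≤ P ∧ a ∉ P := by
  obtain ⟨P, hJP, ⟨hPσ, hPw, hPr, haP⟩, hmax⟩ := zorn_le_nonempty₀
    {P : Ideal R | IsSigmaIdeal σ P ∧ IsWellMixed σ P ∧ P.IsRadical ∧ a ∉ P}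
    (fun c hc hchain y hy => by
      have hmem : ∀ x, x ∈ sSup c ↔ ∃ I ∈ c, x ∈ I := fun x =>
        Submodule.mem_sSup_of_directed ⟨y, hy⟩ hchain.directedOn
      refine ⟨sSup c, ⟨fun x hx => ?_, fun x z hx => ?_, fun x ⟨m, hx⟩ => ?_, fun h => ?_⟩,
        fun I hI => le_sSup hI⟩
      · obtain ⟨I, hI, hx⟩ := (hmem _).1 hx
        exact (hmem _).2 ⟨I, hI, (hc hI).1 x hx⟩
      · obtain ⟨I, hI, hx⟩ := (hmem _).1 hx
        exact (hmem _).2 ⟨I, hI, (hc hI).2.1 x z hx⟩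
      · obtain ⟨I, hI, hx⟩ := (hmem _).1 hx
        exact (hmem _).2 ⟨I, hI, (hc hI).2.2.1 ⟨m, hx⟩⟩
      · obtain ⟨I, hI, hx⟩ := (hmem _).1 h
        exact (hc hI).2.2.2 hx)
    J ⟨hσ, hw, hr, ha⟩
  have hcolon : ∀ b c, b * c ∈ P → c ∉ P → b * a ∈ P := fun b c hbc hc => by
    by_contra hba
    let Q : Ideal R := Submodule.comap (LinearMap.mulLeft R b) P
    have hQ : ∀ x, x ∈ Q ↔ b * x ∈ P := fun x => Iff.rfl
    refine hc (hmax (y := Q) ⟨fun x hx => ?_, fun x z hx => ?_, fun x ⟨m, hx⟩ => ?_, hba⟩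
      (fun x hx => P.mul_mem_left b hx) hbc)
    · exact hPw b x hx
    · have := hPw (b * x) z (by rwa [mul_assoc])
      rwa [hQ, ← mul_assoc]
    · refine hPr ⟨m + 1, ?_⟩
      have : (b * x) ^ (m + 1) = b ^ m * x * (b * x ^ m) := by ring
      rw [LinearMap.mulLeft_apply, this]
      exact P.mul_mem_left _ hx
  refine ⟨P, ⟨fun h => haP (h ▸ Submodule.mem_top), fun {b c} hbc => ?_⟩, hPσ, hJP, haP⟩
  by_contra! h
  have h1 := hcolon b c hbc h.2
  have h2 := hcolon a b (by rwa [mul_comm]) h.1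
  exact haP (hPr ⟨2, by rwa [pow_two]⟩)

end RadicalWellMixed

section PrimeState

open MvPolynomial

variable {K : Type*} [Field K] {n : ℕ} (σK : K →+* K)

lemma shift_iterate_monomial (s : ℕ) (u : Fin n × ℕ →₀ ℕ) :
    (shift σK)^[s] (monomial u (1 : K)) = monomial (u.mapDomain (shiftVar s)) 1 := by
  have hone : ∀ u : Fin n × ℕ →₀ ℕ,
      shift σK (monomial u (1 : K)) = monomial (u.mapDomain (shiftVar 1)) 1 := fun u => by
    rw [shift, eval₂Hom_monomial, map_one, one_mul, monomial_eq, map_one, one_mul,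
      Finsupp.prod_mapDomain_index (fun _ => pow_zero _) (fun _ _ _ => pow_add _ _ _)]
    rfl
  induction s with
  | zero =>
    have : (shiftVar 0 : Fin n × ℕ → Fin n × ℕ) = id := rfl
    simp [this]
  | succ s ih =>
    rw [Function.iterate_succ_apply', ih, hone, ← Finsupp.mapDomain_comp]
    rfl

lemma exists_monom_eq_monomial (f : Fin n → Polynomial ℕ) :
    ∃ u : Fin n × ℕ →₀ ℕ, monom σK f = monomial u (1 : K) := by
  let M : Submonoid (DPoly K n) := MonoidHom.mrange (monomialOneHom K (Fin n × ℕ))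
  have hX : ∀ v : Fin n × ℕ, (X v : DPoly K n) ∈ M := fun v =>
    ⟨Multiplicative.ofAdd (Finsupp.single v 1), rfl⟩
  have hf : monom σK f ∈ M := by
    refine M.prod_mem fun i _ => ?_
    rw [ypow, sexp]
    refine M.prod_mem fun j _ => M.pow_mem ?_ _
    rw [show (X (i, 0) : DPoly K n) = monomial (Finsupp.single (i, 0) 1) 1 from rfl,
      shift_iterate_monomial, Finsupp.mapDomain_single]
    exact hX _
  obtain ⟨u, hu⟩ := hf
  exact ⟨u.toAdd, hu.symm⟩

lemma monomial_mem_iff {P : Ideal (DPoly K n)} (hP : P.IsPrime) (u : Fin n × ℕ →₀ ℕ) :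
    monomial u (1 : K) ∈ P ↔ ∃ v ∈ u.support, (X v : DPoly K n) ∈ P := by
  rw [monomial_eq, map_one, one_mul, Finsupp.prod, hP.prod_mem_iff]
  refine exists_congr fun v => and_congr_right fun hv => ?_
  exact hP.pow_mem_iff_mem _ (Nat.pos_of_ne_zero (Finsupp.mem_support_iff.1 hv))

open BinomialState

/-- The differences of exponents of pure binomials in a prime ideal with monomials outside it. -/
noncomputable def primeLattice (P : Ideal (DPoly K n)) (hP : P.IsPrime) :
    AddSubgroup (Fin n × ℕ →₀ ℤ) where
  carrier := {h | ∃ u v : Fin n × ℕ →₀ ℕ, monomial u (1 : K) ∉ P ∧ monomial v (1 : K) ∉ P ∧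
    monomial u (1 : K) - monomial v 1 ∈ P ∧ diff u v = h}
  zero_mem' := by
    have h1 : monomial (0 : Fin n × ℕ →₀ ℕ) (1 : K) ∉ P :=
      fun h => hP.ne_top (P.eq_top_iff_one.2 h)
    exact ⟨0, 0, h1, h1, by simp, by ext; simp⟩
  add_mem' := by
    rintro _ _ ⟨u, v, hu, hv, huv, rfl⟩ ⟨u', v', hu', hv', huv', rfl⟩
    have hadd : ∀ a b : Fin n × ℕ →₀ ℕ,
        monomial (a + b) (1 : K) = monomial a 1 * monomial b 1 := fun a b => by
      rw [monomial_mul, one_mul]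
    refine ⟨u + u', v + v', ?_, ?_, ?_, ?_⟩
    · rw [hadd]
      exact hP.mul_notMem hu hu'
    · rw [hadd]
      exact hP.mul_notMem hv hv'
    · have : monomial (u + u') (1 : K) - monomial (v + v') 1 =
          monomial u' 1 * (monomial u 1 - monomial v 1) +
          monomial v 1 * (monomial u' 1 - monomial v' 1) := by
        rw [hadd, hadd]
        ring
      rw [this]
      exact add_mem (P.mul_mem_left _ huv) (P.mul_mem_left _ huv')
    · ext w
      simp only [diff_apply, Finsupp.add_apply]
      push_cast
      ring
  neg_mem' := by
    rintro _ ⟨u, v, hu, hv, huv, rfl⟩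
    refine ⟨v, u, hv, hu, ?_, ?_⟩
    · rw [← neg_sub]
      exact neg_mem huv
    · ext w
      simp

lemma sub_mem_of_diff_mem {P : Ideal (DPoly K n)} {hP : P.IsPrime} {u v : Fin n × ℕ →₀ ℕ}
    (h : diff u v ∈ primeLattice P hP) : monomial u (1 : K) - monomial v 1 ∈ P := by
  obtain ⟨u', v', -, hv', huv', he⟩ := h
  have hadd : u' + v = u + v' := by
    ext w
    have := DFunLike.congr_fun he w
    simp only [diff_apply, Finsupp.add_apply] at this ⊢
    omega
  refine (hP.mem_or_mem (x := monomial v' (1 : K)) ?_).resolve_left hv'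
  have : monomial v' (1 : K) * (monomial u 1 - monomial v 1) =
      monomial v 1 * (monomial u' 1 - monomial v' 1) := by
    simp only [mul_sub, monomial_mul, one_mul]
    rw [add_comm v' u, ← hadd, add_comm u' v, add_comm v' v]
  rw [this]
  exact P.mul_mem_left _ huv'

lemma X_notMem_of_mem_support {P : Ideal (DPoly K n)} {hP : P.IsPrime} {h : Fin n × ℕ →₀ ℤ}
    (hh : h ∈ primeLattice P hP) {w : Fin n × ℕ} (hw : w ∈ h.support) :
    (X w : DPoly K n) ∉ P := fun hX => by
  obtain ⟨u, v, hu, hv, -, rfl⟩ := hh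
  rw [monomial_mem_iff hP] at hu hv
  have : u w ≠ 0 ∨ v w ≠ 0 := by
    by_contra! h0
    simp [h0.1, h0.2] at hw
  rcases this with h0 | h0
  · exact hu ⟨w, Finsupp.mem_support_iff.2 h0, hX⟩
  · exact hv ⟨w, Finsupp.mem_support_iff.2 h0, hX⟩

lemma diff_toNat (h : Fin n × ℕ →₀ ℤ) :
    diff (h.mapRange Int.toNat rfl) ((-h).mapRange Int.toNat rfl) = h := by
  ext w
  simp only [diff_apply, Finsupp.mapRange_apply, Finsupp.neg_apply]
  omega

lemma diff_mapDomain (u v : Fin n × ℕ →₀ ℕ) (f : Fin n × ℕ → Fin n × ℕ) :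
    diff (u.mapDomain f) (v.mapDomain f) = (diff u v).mapDomain f := by
  have h : ∀ u : Fin n × ℕ →₀ ℕ, (u.mapDomain f).mapRange (Nat.cast : ℕ → ℤ) Nat.cast_zero =
      (u.mapRange (Nat.cast : ℕ → ℤ) Nat.cast_zero).mapDomain f := fun u =>
    (Finsupp.mapDomain_mapRange f u Nat.cast Nat.cast_zero Nat.cast_add).symm
  rw [diff, h, h]
  exact (map_sub (Finsupp.mapDomain.addMonoidHom (M := ℤ) f) _ _).symm

variable {σK}

lemma shift_iterate_mem {P : Ideal (DPoly K n)} (hσ : IsSigmaIdeal (shift σK) P)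
    {p : DPoly K n} (hp : p ∈ P) (s : ℕ) : (shift σK)^[s] p ∈ P := by
  induction s with
  | zero => exact hp
  | succ s ih =>
    rw [Function.iterate_succ_apply']
    exact hσ _ ih

lemma shift_monomial_sub_mem {P : Ideal (DPoly K n)} (hσ : IsSigmaIdeal (shift σK) P)
    {u v : Fin n × ℕ →₀ ℕ} (h : monomial u (1 : K) - monomial v 1 ∈ P) (s : ℕ) :
    monomial (u.mapDomain (shiftVar s)) (1 : K) - monomial (v.mapDomain (shiftVar s)) 1 ∈ P := by
  have := shift_iterate_mem hσ h s
  rwa [iterate_map_sub, shift_iterate_monomial, shift_iterate_monomial] at this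

/-- The state attached to a prime σ-ideal. -/
noncomputable def primeState (P : Ideal (DPoly K n)) (hP : P.IsPrime)
    (hσ : IsSigmaIdeal (shift σK) P) : BinomialState n where
  dead := {v | (X v : DPoly K n) ∈ P}
  lat := primeLattice P hP
  shift_dead v hv s := by
    have := shift_iterate_mem hσ (p := monomial (Finsupp.single v 1) 1) hv s
    rwa [shift_iterate_monomial, Finsupp.mapDomain_single] at this
  alive h hh v hv := X_notMem_of_mem_support hh hv
  shift_lat h hh s hs := by
    have hsub := shift_monomial_sub_mem hσ
      (sub_mem_of_diff_mem (P := P) (hP := hP) ((diff_toNat h).symm ▸ hh)) s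
    have hmem : ∀ k : Fin n × ℕ →₀ ℤ, k.support ⊆ h.support →
        monomial ((k.mapRange Int.toNat rfl).mapDomain (shiftVar s)) (1 : K) ∉ P := by
      intro k hk hkP
      classical
      obtain ⟨w, hw, hwP⟩ := (monomial_mem_iff hP _).1 hkP
      obtain ⟨w', hw', rfl⟩ := Finset.mem_image.1 (Finsupp.mapDomain_support hw)
      exact hs w' (hk (Finsupp.support_mapRange hw')) hwP
    refine ⟨_, _, hmem h subset_rfl, hmem (-h) (Finsupp.support_neg h).subset, hsub, ?_⟩
    rw [diff_mapDomain, diff_toNat]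
  balanced h hh s v hv hd := by
    have hsub := shift_monomial_sub_mem hσ
      (sub_mem_of_diff_mem (P := P) (hP := hP) ((diff_toNat h).symm ▸ hh)) s
    have hpos : monomial ((h.mapRange Int.toNat rfl).mapDomain (shiftVar s)) (1 : K) ∈ P := by
      refine (monomial_mem_iff hP _).2 ⟨shiftVar s v, ?_, hd⟩
      rw [Finsupp.mem_support_iff, Finsupp.mapDomain_apply (shiftVar_injective s),
        Finsupp.mapRange_apply]
      omega
    have hneg := (Submodule.sub_mem_iff_right _ hpos).1 hsub
    classical
    obtain ⟨w, hw, hwP⟩ := (monomial_mem_iff hP _).1 hneg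
    obtain ⟨w', hw', rfl⟩ := Finset.mem_image.1 (Finsupp.mapDomain_support hw)
    refine ⟨w', ?_, hwP⟩
    rw [Finsupp.mem_support_iff, Finsupp.mapRange_apply, Finsupp.neg_apply] at hw'
    omega

lemma primeState_holds_iff {P : Ideal (DPoly K n)} (hP : P.IsPrime)
    (hσ : IsSigmaIdeal (shift σK) P) (u v : Fin n × ℕ →₀ ℕ) :
    (primeState P hP hσ).Holds u v ↔ monomial u (1 : K) - monomial v 1 ∈ P := by
  have hvan : ∀ u, (primeState P hP hσ).Vanishes u ↔ monomial u (1 : K) ∈ P := fun u =>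
    (monomial_mem_iff hP u).symm
  rw [Holds, hvan, hvan]
  constructor
  · rintro (⟨hu, hv⟩ | ⟨-, -, h⟩)
    · exact sub_mem hu hv
    · exact sub_mem_of_diff_mem (hP := hP) h
  · intro h
    by_cases hu : monomial u (1 : K) ∈ P
    · exact Or.inl ⟨hu, (Submodule.sub_mem_iff_right _ hu).1 h⟩
    · have hv : monomial v (1 : K) ∉ P := fun hv =>
        hu ((Submodule.sub_mem_iff_left _ hv).1 h)
      exact Or.inr ⟨hu, hv, u, v, hu, hv, h, rfl⟩

/-- A family of pure binomials has the same radical well-mixed closure as some finite subfamily. -/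
theorem exists_finite_subset_rwmClosure {S : Set (DPoly K n)}
    (hS : ∀ p ∈ S, IsPureBinomial σK p) :
    ∃ T ⊆ S, T.Finite ∧ S ⊆ rwmClosure (shift σK) T := by
  classical
  by_contra! hcon
  have hP : ∀ T : Finset S, ∃ P : Ideal (DPoly K n), P.IsPrime ∧ IsSigmaIdeal (shift σK) P ∧
      (∀ p ∈ T, (p : DPoly K n) ∈ P) ∧ ¬ S ⊆ P := fun T => by
    obtain ⟨b, hb, hbT⟩ := Set.not_subset.1 (hcon (Set.image Subtype.val (T : Set S))
      (by simp) (T.finite_toSet.image _))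
    obtain ⟨P, hP, hσ, hle, hbP⟩ := exists_prime_sigmaIdeal (isSigmaIdeal_rwmClosure _ _)
      (isWellMixed_rwmClosure _ _) (isRadical_rwmClosure _ _) hbT
    exact ⟨P, hP, hσ, fun p hp => hle (subset_rwmClosure _ _ ⟨p, hp, rfl⟩),
      fun h => hbP (h hb)⟩
  choose P hP hσ hTP hSP using hP
  let U : Ultrafilter (Finset S) := Ultrafilter.of Filter.atTop
  obtain ⟨T, hT⟩ := (eventually_holds U fun T => primeState (P T) (hP T) (hσ T)).exists
  refine hSP T fun p hp => ?_
  obtain ⟨f, g, hfg⟩ := hS p hp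
  obtain ⟨u, hu⟩ := exists_monom_eq_monomial σK f
  obtain ⟨v, hv⟩ := exists_monom_eq_monomial σK g
  rw [hu, hv] at hfg
  rw [SetLike.mem_coe, hfg, ← primeState_holds_iff (hP T) (hσ T)]
  refine hT u v ?_
  have hle : (U : Filter (Finset S)) ≤ Filter.atTop := Ultrafilter.of_le _
  filter_upwards [hle (Filter.eventually_ge_atTop {⟨p, hp⟩})] with T' hT'
  rw [primeState_holds_iff, ← hfg]
  exact hTP T' ⟨p, hp⟩ (hT' (Finset.mem_singleton_self _))

end PrimeState

/-- For a pure binomial σ-ideal `I`, `⟨I⟩_r` is finitely generated as a radical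
well-mixed σ-ideal. -/
theorem stmt11 {K : Type*} [Field K] [CharZero K] {n : ℕ} (σK : K →+* K)
    (I : Ideal (DPoly K n)) (hI : IsPureBinomialSigmaIdeal σK I) :
    FinGenAsRWM (shift σK) (rwmClosure (shift σK) (I : Set (DPoly K n))) := by
  obtain ⟨S, hS, rfl⟩ := hI
  obtain ⟨T, hTS, hT, hST⟩ := exists_finite_subset_rwmClosure hS
  have hTI : T ⊆ rwmClosure (shift σK) (sigmaIdealGen (shift σK) S : Set (DPoly K n)) := by
    refine fun p hp => subset_rwmClosure _ _ ?_
    simp only [sigmaIdealGen, SetLike.mem_coe, Submodule.mem_sInf]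
    exact fun J hJ => hJ.1 (hTS hp)
  refine ⟨T, hT, hTI, le_antisymm (rwmClosure_le ?_ (isSigmaIdeal_rwmClosure _ _)
    (isWellMixed_rwmClosure _ _) (isRadical_rwmClosure _ _)) (rwmClosure_le hTI
    (isSigmaIdeal_rwmClosure _ _) (isWellMixed_rwmClosure _ _) (isRadical_rwmClosure _ _))⟩
  exact sInf_le (a := rwmClosure (shift σK) T) ⟨hST, isSigmaIdeal_rwmClosure _ _⟩
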